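/- Let k ≥ 2 and let φ : Σ_k → ℝ be a continuous function with φ(x) > 0 for all x in the full shift Σ_k. Set H = sup{ h_μ(σ) / ∫ φ dμ : μ a σ-invariant Borel probability measure on Σ_k }. Then H > 0, and for every h ∈ (0, H) there exists an ergodic σ-invariant Borel probability measure μ on Σ_k such that h_μ(σ) / ∫ φ dμ = h. -/

import Mathlib

open MeasureTheory Real Filter Set

/-- The shift map on the full shift `ℤ → S`. -/
def shiftMap {S : Type*} : (ℤ → S) → (ℤ → S) := fun x i => x (i + 1)

/-- The subshift of finite type determined by the 0-1 matrix `A : S → S → ℕ`. -/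
def SFT {S : Type*} (A : S → S → ℕ) : Set (ℤ → S) :=
  {x | ∀ i : ℤ, A (x i) (x (i + 1)) = 1}

/-- `w : Fin n → S` is an admissible word for the 0-1 matrix `A`. -/
def IsAdmissible {S : Type*} (A : S → S → ℕ) {n : ℕ} (w : Fin n → S) : Prop :=
  ∀ (i : ℕ) (h : i + 1 < n), A (w ⟨i, Nat.lt_of_succ_lt h⟩) (w ⟨i + 1, h⟩) = 1

/-- The shift map restricted to the SFT determined by `A`. -/
def restrictShift {S : Type*} (A : S → S → ℕ) (x : ↥(SFT A)) : ↥(SFT A) :=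
  ⟨shiftMap x.1, fun i => x.2 (i + 1)⟩

open Classical in
/-- The `n`-block recoding matrix `A_n`, indexed by admissible words of length `n`:
`(b,b')`-entry is 1 iff the last `n-1` letters of `b` coincide with the first `n-1`
letters of `b'`. -/
noncomputable def blockMatrix {S : Type*} (A : S → S → ℕ) (n : ℕ) :
    {w : Fin n → S // IsAdmissible A w} → {w : Fin n → S // IsAdmissible A w} → ℕ :=
  fun b b' =>
    if ∀ (p : ℕ) (h : p + 1 < n), b.1 ⟨p + 1, h⟩ = b'.1 ⟨p, Nat.lt_of_succ_lt h⟩ then 1 else 0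

open Classical in
/-- `m`-th power of the matrix `A : S → S → ℕ`. -/
noncomputable def matPow {S : Type*} [Fintype S] (A : S → S → ℕ) : ℕ → S → S → ℕ
  | 0 => fun i j => if i = j then 1 else 0
  | (m + 1) => fun i j => ∑ r : S, matPow A m i r * A r j

/-- A nonnegative matrix is irreducible if for every `(i,j)` some power has positive
`(i,j)`-entry. -/
def IrreducibleMat {S : Type*} [Fintype S] (A : S → S → ℕ) : Prop :=
  ∀ i j : S, ∃ m : ℕ, 1 ≤ m ∧ 0 < matPow A m i j

noncomputable instance wordsFintype {S : Type*} [Fintype S] (A : S → S → ℕ) (n : ℕ) :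
    Fintype {w : Fin n → S // IsAdmissible A w} := Fintype.ofFinite _

/-- Shannon entropy of the partition of the full shift into cylinders of length `n`
(based at coordinates `0, …, n-1`). -/
noncomputable def blockH {k : ℕ} (μ : Measure (ℤ → Fin k)) (n : ℕ) : ℝ :=
  ∑ w : Fin n → Fin k,
    Real.negMulLog (μ {x | ∀ p : Fin n, x ((p : ℕ) : ℤ) = w p}).toReal

/-- The measure-theoretic (Kolmogorov–Sinai) entropy of a shift-invariant measure `μ`
on the full shift: since the coordinate partition is generating and `blockH μ` is
subadditive, it equals `inf_{n ≥ 1} blockH μ n / n`. -/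
noncomputable def mEntropy {k : ℕ} (μ : Measure (ℤ → Fin k)) : ℝ :=
  ⨅ n : ℕ, blockH μ (n + 1) / (n + 1)

/-- The number of admissible words of length `n` for `A`. -/
noncomputable def wordCount {k : ℕ} (A : Fin k → Fin k → ℕ) (n : ℕ) : ℕ :=
  Nat.card {w : Fin n → Fin k // IsAdmissible A w}

/-- The topological entropy of the SFT determined by an irreducible matrix `A`:
the exponential growth rate of the number of admissible words, which by
subadditivity equals `inf_{n ≥ 1} (log wordCount n) / n`. -/
noncomputable def topEnt {k : ℕ} (A : Fin k → Fin k → ℕ) : ℝ :=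
  ⨅ n : ℕ, Real.log (wordCount A (n + 1)) / (n + 1)

/-- `μ` is a `σ`-invariant Borel probability measure carried by the SFT `Σ_A`. -/
def InvProbOn {k : ℕ} (A : Fin k → Fin k → ℕ) (μ : Measure (ℤ → Fin k)) : Prop :=
  IsProbabilityMeasure μ ∧ MeasurePreserving shiftMap μ μ ∧ μ (SFT A) = 1

open ProbabilityTheory

section Entropy

variable {Ω S T : Type*} [MeasurableSpace Ω]

/-- Shannon entropy of the law of a finite-valued observable `f` under `μ`. -/
noncomputable def obsEntropy [Fintype S] (μ : Measure Ω) (f : Ω → S) : ℝ :=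
  ∑ s, negMulLog (μ.real (f ⁻¹' {s}))

lemma blockH_eq_obsEntropy {k : ℕ} (μ : Measure (ℤ → Fin k)) (n : ℕ) :
    blockH μ n = obsEntropy μ (fun x (p : Fin n) => x ((p : ℕ) : ℤ)) := by
  unfold blockH obsEntropy
  refine Finset.sum_congr rfl fun w _ => ?_
  rw [Measure.real]
  congr 3
  ext x
  simp [funext_iff]

lemma negMulLog_add_le {x y : ℝ} (hx : 0 ≤ x) (hy : 0 ≤ y) :
    negMulLog (x + y) ≤ negMulLog x + negMulLog y := by
  rcases hx.eq_or_lt with rfl | hx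
  · simp
  rcases hy.eq_or_lt with rfl | hy
  · simp
  have h1 : log x ≤ log (x + y) := log_le_log hx (by linarith)
  have h2 : log y ≤ log (x + y) := log_le_log hy (by linarith)
  simp only [negMulLog]
  nlinarith

lemma negMulLog_sum_le {ι : Type*} (s : Finset ι) (f : ι → ℝ) (hf : ∀ i ∈ s, 0 ≤ f i) :
    negMulLog (∑ i ∈ s, f i) ≤ ∑ i ∈ s, negMulLog (f i) := by
  classical
  induction s using Finset.induction_on with
  | empty => simp
  | insert a s ha ih =>
    rw [Finset.sum_insert ha, Finset.sum_insert ha]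
    have h1 := hf a (Finset.mem_insert_self a s)
    have h2 : ∀ i ∈ s, 0 ≤ f i := fun i hi => hf i (Finset.mem_insert_of_mem hi)
    linarith [negMulLog_add_le h1 (Finset.sum_nonneg h2), ih h2]

lemma negMulLog_le_of_le {r a b : ℝ} (hr : 0 ≤ r) (ha : r ≤ a) (hb : r ≤ b) :
    negMulLog r ≤ -(r * log a) - r * log b + (a * b - r) := by
  rcases hr.eq_or_lt with rfl | hr
  · simpa using mul_nonneg ha hb
  have ha' : 0 < a := by linarith
  have hb' : 0 < b := by linarith
  have h := log_le_sub_one_of_pos (x := a * b / r) (by positivity)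
  rw [log_div (by positivity) hr.ne', log_mul ha'.ne' hb'.ne'] at h
  have h' := mul_le_mul_of_nonneg_left h hr.le
  have : r * (a * b / r - 1) = a * b - r := by field_simp
  rw [this] at h'
  simp only [negMulLog]
  linarith

lemma sum_negMulLog_prod [Fintype S] (p : S → ℝ) (hp : ∑ s, p s = 1) (q : ℕ) :
    ∑ v : Fin q → S, negMulLog (∏ j, p (v j)) = q * ∑ s, negMulLog (p s) := by
  induction q with
  | zero => simp
  | succ q ih =>
    have hone : ∑ v : Fin q → S, ∏ j, p (v j) = 1 := by
      rw [← Fintype.prod_sum]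
      simp [hp]
    rw [← (Fin.consEquiv fun _ => S).sum_comp, Fintype.sum_prod_type]
    simp only [Fin.consEquiv_apply, Fin.prod_univ_succ, Fin.cons_zero, Fin.cons_succ,
      negMulLog_mul, Finset.sum_add_distrib, ← Finset.sum_mul, ← Finset.mul_sum, hone, ih, hp]
    push_cast
    ring

lemma obsEntropy_nonneg [Fintype S] (μ : Measure Ω) [IsProbabilityMeasure μ] (f : Ω → S) :
    0 ≤ obsEntropy μ f :=
  Finset.sum_nonneg fun _ _ => negMulLog_nonneg measureReal_nonneg measureReal_le_one

lemma obsEntropy_le_card [Fintype S] (μ : Measure Ω) (f : Ω → S) :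
    obsEntropy μ f ≤ Fintype.card S := by
  calc obsEntropy μ f ≤ ∑ _s : S, (1 : ℝ) := Finset.sum_le_sum fun s _ => by
        have : 0 ≤ μ.real (f ⁻¹' {s}) := measureReal_nonneg
        linarith [negMulLog_le_one_sub_self this]
    _ = Fintype.card S := by simp

variable [MeasurableSpace S] [MeasurableSingletonClass S]

lemma measureReal_preimage_comp_singleton [Fintype S] [DecidableEq T] (μ : Measure Ω)
    [IsFiniteMeasure μ] {f : Ω → S} (hf : Measurable f) (g : S → T) (t : T) :
    μ.real ((g ∘ f) ⁻¹' {t}) = ∑ s with g s = t, μ.real (f ⁻¹' {s}) := by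
  rw [← measureReal_biUnion_finset]
  · congr 1
    ext x
    simp
  · intro a _ b _ hab
    exact Disjoint.preimage f (by simpa using hab)
  · exact fun s _ => hf (measurableSet_singleton s)

lemma obsEntropy_comp_le [Fintype S] [Fintype T] (μ : Measure Ω) [IsFiniteMeasure μ]
    {f : Ω → S} (hf : Measurable f) (g : S → T) :
    obsEntropy μ (g ∘ f) ≤ obsEntropy μ f := by
  classical
  unfold obsEntropy
  calc ∑ t, negMulLog (μ.real ((g ∘ f) ⁻¹' {t}))
      = ∑ t, negMulLog (∑ s with g s = t, μ.real (f ⁻¹' {s})) := by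
        simp_rw [measureReal_preimage_comp_singleton μ hf g]
    _ ≤ ∑ t, ∑ s with g s = t, negMulLog (μ.real (f ⁻¹' {s})) :=
        Finset.sum_le_sum fun t _ => negMulLog_sum_le _ _ fun _ _ => measureReal_nonneg
    _ = ∑ s, negMulLog (μ.real (f ⁻¹' {s})) := Finset.sum_fiberwise _ _ _

lemma obsEntropy_map {Ω' : Type*} [MeasurableSpace Ω'] [Fintype S] (μ : Measure Ω)
    {h : Ω → Ω'} (hh : Measurable h) {f : Ω' → S} (hf : Measurable f) :
    obsEntropy (μ.map h) f = obsEntropy μ (f ∘ h) := by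
  unfold obsEntropy
  refine Finset.sum_congr rfl fun s _ => ?_
  rw [map_measureReal_apply hh (hf (measurableSet_singleton s)), preimage_comp]

lemma sum_measureReal_preimage_singleton_eq_one [Fintype S] (μ : Measure Ω)
    [IsProbabilityMeasure μ] {f : Ω → S} (hf : Measurable f) :
    ∑ s, μ.real (f ⁻¹' {s}) = 1 := by
  have h := measureReal_preimage_comp_singleton μ hf (fun _ => ()) ()
  have huniv : ((fun _ : S => ()) ∘ f) ⁻¹' {()} = univ := by
    ext
    simp
  simpa [huniv] using h.symm

lemma obsEntropy_prodMk_le [MeasurableSpace T] [MeasurableSingletonClass T] [Fintype S]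
    [Fintype T] (μ : Measure Ω) [IsProbabilityMeasure μ]
    {f : Ω → S} (hf : Measurable f) {g : Ω → T} (hg : Measurable g) :
    obsEntropy μ (fun x => (f x, g x)) ≤ obsEntropy μ f + obsEntropy μ g := by
  classical
  have hfg : Measurable fun x => (f x, g x) := hf.prodMk hg
  set r : S × T → ℝ := fun u => μ.real ((fun x => (f x, g x)) ⁻¹' {u}) with hrdef
  set a : S → ℝ := fun s => μ.real (f ⁻¹' {s}) with hadef
  set b : T → ℝ := fun t => μ.real (g ⁻¹' {t}) with hbdef
  have ha : ∀ s, ∑ t, r (s, t) = a s := fun s => by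
    have h := measureReal_preimage_comp_singleton μ hfg Prod.fst s
    rw [Finset.sum_filter, Fintype.sum_prod_type, Finset.sum_eq_single s] at h
    · simpa [hadef, hrdef, Function.comp_def] using h.symm
    · intro s' _ hs'
      simp [hs']
    · simp
  have hb : ∀ t, ∑ s, r (s, t) = b t := fun t => by
    have h := measureReal_preimage_comp_singleton μ hfg Prod.snd t
    rw [Finset.sum_filter, Fintype.sum_prod_type_right, Finset.sum_eq_single t] at h
    · simpa [hbdef, hrdef, Function.comp_def] using h.symm
    · intro t' _ ht'
      simp [ht']
    · simp
  have ha1 : ∑ s, a s = 1 := sum_measureReal_preimage_singleton_eq_one μ hf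
  have hb1 : ∑ t, b t = 1 := sum_measureReal_preimage_singleton_eq_one μ hg
  have hr1 : ∑ u, r u = 1 := sum_measureReal_preimage_singleton_eq_one μ hfg
  calc ∑ u, negMulLog (r u)
      ≤ ∑ u : S × T, (-(r u * log (a u.1)) - r u * log (b u.2) + (a u.1 * b u.2 - r u)) := by
        refine Finset.sum_le_sum fun u _ => negMulLog_le_of_le measureReal_nonneg ?_ ?_
        · rw [← ha]
          exact Finset.single_le_sum (f := fun t => r (u.1, t))
            (fun _ _ => measureReal_nonneg) (Finset.mem_univ u.2)
        · rw [← hb]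
          exact Finset.single_le_sum (f := fun s => r (s, u.2))
            (fun _ _ => measureReal_nonneg) (Finset.mem_univ u.1)
    _ = ∑ s, negMulLog (a s) + ∑ t, negMulLog (b t) := by
        rw [Finset.sum_add_distrib, Finset.sum_sub_distrib, Finset.sum_sub_distrib, hr1,
          Fintype.sum_prod_type, Fintype.sum_prod_type_right, Fintype.sum_prod_type]
        have e1 : ∑ s, ∑ t, -(r (s, t) * log (a s)) = ∑ s, negMulLog (a s) := by
          refine Finset.sum_congr rfl fun s _ => ?_
          rw [Finset.sum_neg_distrib, ← Finset.sum_mul, ha, negMulLog, neg_mul]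
        have e2 : ∑ t, ∑ s, r (s, t) * log (b t) = -∑ t, negMulLog (b t) := by
          rw [← Finset.sum_neg_distrib]
          refine Finset.sum_congr rfl fun t _ => ?_
          rw [← Finset.sum_mul, hb, negMulLog, neg_mul, neg_neg]
        have e3 : ∑ s, ∑ t, a s * b t = 1 := by
          simp_rw [← Finset.mul_sum, hb1, mul_one, ha1]
        rw [e1, e2, e3]
        ring

end Entropy

section Bernoulli

variable {B : Type*} [MeasurableSpace B]

lemma measurable_shiftMap : Measurable (shiftMap : (ℤ → B) → ℤ → B) :=
  measurable_pi_lambda _ fun i => measurable_pi_apply (i + 1)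

lemma shiftMap_iterate_apply {S : Type*} (n : ℕ) (x : ℤ → S) (i : ℤ) :
    shiftMap^[n] x i = x (i + n) := by
  induction n generalizing x with
  | zero => simp
  | succ n ih =>
    rw [Function.iterate_succ_apply, ih, shiftMap]
    push_cast
    ring_nf

lemma measurePreserving_shiftMap_infinitePi (p : Measure B) [IsProbabilityMeasure p] :
    MeasurePreserving shiftMap (Measure.infinitePi fun _ : ℤ => p)
      (Measure.infinitePi fun _ : ℤ => p) :=
  ⟨measurable_shiftMap, Measure.map_infinitePi_infinitePi_of_inj (add_left_injective (1 : ℤ))⟩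

lemma exists_disjoint_image_add (I : Finset ℤ) :
    ∃ n : ℕ, Disjoint I (I.image (· + (n : ℤ))) := by
  obtain ⟨a, ha⟩ := I.finite_toSet.bddBelow
  obtain ⟨b, hb⟩ := I.finite_toSet.bddAbove
  refine ⟨(b - a + 1).toNat, Finset.disjoint_left.2 fun i hi hi' => ?_⟩
  obtain ⟨j, hj, rfl⟩ := Finset.mem_image.1 hi'
  have h1 := ha hj
  have h2 := hb hi
  change j + _ ≤ b at h2
  omega

open scoped symmDiff in
lemma ergodic_shiftMap_infinitePi (p : Measure B) [IsProbabilityMeasure p] :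
    Ergodic shiftMap (Measure.infinitePi fun _ : ℤ => p) := by
  set P := Measure.infinitePi fun _ : ℤ => p with hP
  have hpres := measurePreserving_shiftMap_infinitePi p
  refine ⟨hpres, ⟨fun s hs hinv => ?_⟩⟩
  have hring : IsSetRing (measurableCylinders fun _ : ℤ => B) :=
    ⟨empty_mem_measurableCylinders _, fun _ _ => union_mem_measurableCylinders,
      fun _ _ => sdiff_mem_measurableCylinders⟩
  have key : ∀ ε : ℝ, 0 < ε → |P.real s - P.real s * P.real s| ≤ 4 * ε := by
    intro ε hε
    obtain ⟨t, ht, hts⟩ := exists_measure_symmDiff_lt_of_generateFrom_isSetRing (μ := P) hring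
      ⟨{univ}, countable_singleton _, by
        simpa using univ_mem_measurableCylinders fun _ : ℤ => B, by simp⟩
      generateFrom_measurableCylinders.symm hs (ENNReal.ofReal_pos.2 hε)
    have hts' : P.real (t ∆ s) < ε := by
      rw [Measure.real]
      exact (ENNReal.lt_ofReal_iff_toReal_lt (measure_ne_top _ _)).1 hts
    obtain ⟨I, S, hS, rfl⟩ := (mem_measurableCylinders _).1 ht
    obtain ⟨n, hn⟩ := exists_disjoint_image_add I
    have htm : MeasurableSet (cylinder (α := fun _ : ℤ => B) I S) :=
      .cylinder (α := fun _ : ℤ => B) I hS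
    have hpn := hpres.iterate n
    have hinvn : shiftMap^[n] ⁻¹' s = s := Function.IsFixedPt.preimage_iterate hinv n
    set t := cylinder (α := fun _ : ℤ => B) I S
    set t' := shiftMap^[n] ⁻¹' t with ht'
    have htm' : MeasurableSet t' := hpn.measurable htm
    have hPt' : P.real t' = P.real t := hpn.measureReal_preimage htm.nullMeasurableSet
    have hts'' : P.real (t' ∆ s) < ε := by
      have : t' ∆ s = shiftMap^[n] ⁻¹' (t ∆ s) := by
        conv_lhs => rw [← hinvn]
        rfl
      rw [this, hpn.measureReal_preimage (htm.symmDiff hs).nullMeasurableSet]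
      exact hts'
    have hindep : P.real (t ∩ t') = P.real t * P.real t' := by
      have hI : iIndepFun (fun (i : ℤ) (ω : ℤ → B) => ω i) P :=
        iIndepFun_infinitePi (X := fun _ b => b) fun _ => measurable_id
      have h2 := hI.indepFun_finset I (I.image (· + (n : ℤ))) hn fun i => measurable_pi_apply i
      have hS' : MeasurableSet {v : I.image (· + (n : ℤ)) → B |
          (fun i : I => v ⟨i + n, Finset.mem_image_of_mem _ i.2⟩) ∈ S} :=
        (measurable_pi_lambda _ fun i => measurable_pi_apply _) hS
      have h3 := h2.measure_inter_preimage_eq_mul _ _ hS hS'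
      have e : t' = (fun (a : ℤ → B) (i : I.image (· + (n : ℤ))) => a i) ⁻¹'
          {v | (fun i : I => v ⟨i + n, Finset.mem_image_of_mem _ i.2⟩) ∈ S} := by
        ext ω
        simp only [ht', t, mem_preimage, mem_cylinder, mem_ofPred_eq]
        exact iff_of_eq (congrArg (· ∈ S) (funext fun i => shiftMap_iterate_apply n ω i))
      rw [Measure.real, Measure.real, Measure.real, ← ENNReal.toReal_mul, e]
      exact congrArg ENNReal.toReal h3
    have hb1 : |P.real t - P.real s| ≤ P.real (t ∆ s) :=
      abs_measureReal_sub_le_measureReal_symmDiff htm.nullMeasurableSet hs.nullMeasurableSet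
    have hb2 : |P.real (t ∩ t') - P.real s| ≤ P.real (t ∆ s) + P.real (t' ∆ s) := by
      refine (abs_measureReal_sub_le_measureReal_symmDiff (htm.inter htm').nullMeasurableSet
        hs.nullMeasurableSet).trans
        ((measureReal_mono ?_).trans (measureReal_union_le _ _))
      intro x
      simp only [mem_symmDiff, mem_inter_iff, mem_union]
      tauto
    rw [hindep, hPt'] at hb2
    have h0 : 0 ≤ P.real s := measureReal_nonneg
    have h1 : P.real s ≤ 1 := measureReal_le_one
    have h0' : 0 ≤ P.real t := measureReal_nonneg
    have h1' : P.real t ≤ 1 := measureReal_le_one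
    have hb3 : |P.real t * P.real t - P.real s * P.real s| ≤ 2 * ε := by
      have : P.real t * P.real t - P.real s * P.real s =
          (P.real t + P.real s) * (P.real t - P.real s) := by ring
      rw [this, abs_mul, abs_of_nonneg (by positivity)]
      have := abs_nonneg (P.real t - P.real s)
      nlinarith
    rw [abs_le] at *
    constructor <;> linarith [hb2.1, hb2.2, hb3.1, hb3.2]
  have hzero : P.real s - P.real s * P.real s = 0 := by
    refine abs_nonpos_iff.1 (le_of_forall_pos_le_add fun ε hε => ?_)
    have := key (ε / 4) (by positivity)
    linarith
  rw [eventuallyConst_set']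
  have hor : P.real s = 0 ∨ P.real s = 1 := by
    have : P.real s * (1 - P.real s) = 0 := by linarith
    rcases mul_eq_zero.1 this with h | h
    · exact Or.inl h
    · exact Or.inr (by linarith)
  rcases hor with h | h
  · exact Or.inl (ae_eq_empty.2 ((measureReal_eq_zero_iff).1 h))
  · refine Or.inr (ae_eq_univ.2 ((prob_compl_eq_zero_iff hs).2 ?_))
    rw [Measure.real] at h
    exact (ENNReal.toReal_eq_one_iff _).1 h

end Bernoulli

section Window

variable {B : Type*} [TopologicalSpace B] [Finite B]

/-- A continuous function on a full shift is determined, up to `ε`, by a finite window. -/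
lemma exists_window {φ : (ℤ → B) → ℝ} (hφ : Continuous φ) {ε : ℝ} (hε : 0 < ε) :
    ∃ M : ℕ, ∀ x y : ℤ → B, (∀ i : ℤ, |i| ≤ M → x i = y i) → |φ x - φ y| < ε := by
  by_contra! hcon
  choose x y hxy hφxy using hcon
  let U : Ultrafilter ℕ := hyperfilter ℕ
  have hU : (U : Filter ℕ) ≤ atTop := by
    rw [← Nat.cofinite_eq_atTop]
    exact hyperfilter_le_cofinite
  obtain ⟨a, -, ha⟩ := isCompact_univ.ultrafilter_le_nhds (U.map x) (by simp)
  have hx : Tendsto x U (nhds a) := ha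
  have hy : Tendsto y U (nhds a) := by
    rw [tendsto_pi_nhds] at hx ⊢
    intro i
    refine (hx i).congr' ?_
    filter_upwards [hU (eventually_ge_atTop i.natAbs)] with m hm
    exact hxy m i (by
      rw [Int.abs_eq_natAbs]
      exact Int.ofNat_le.2 hm)
  have h0 : Tendsto (fun m => |φ (x m) - φ (y m)|) U (nhds 0) := by
    have := ((hφ.tendsto a).comp hx).sub ((hφ.tendsto a).comp hy)
    simpa using this.abs
  have := ge_of_tendsto' h0 hφxy
  linarith

lemma integrable_of_continuous [DiscreteTopology B] [MeasurableSpace B]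
    [MeasurableSingletonClass B] (P : Measure (ℤ → B)) [IsFiniteMeasure P]
    {φ : (ℤ → B) → ℝ} (hφ : Continuous φ) :
    Integrable φ P :=
  hφ.integrable_of_hasCompactSupport (HasCompactSupport.of_compactSpace φ)

end Window

section SimplexMeasure

variable {B : Type*} [Fintype B] [MeasurableSpace B]

/-- The measure on a finite alphabet with given weights. -/
noncomputable def simplexMeasure (q : B → ℝ) : Measure B :=
  ∑ b, ENNReal.ofReal (q b) • Measure.dirac b

variable [MeasurableSingletonClass B]

lemma simplexMeasure_singleton (q : B → ℝ) (b : B) :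
    simplexMeasure q {b} = ENNReal.ofReal (q b) := by
  classical
  simp [simplexMeasure, Set.indicator_apply]

lemma simplexMeasure_real_singleton (q : stdSimplex ℝ B) (b : B) :
    (simplexMeasure q.1).real {b} = q.1 b := by
  rw [Measure.real, simplexMeasure_singleton, ENNReal.toReal_ofReal (q.2.1 b)]

instance isProbabilityMeasure_simplexMeasure (q : stdSimplex ℝ B) :
    IsProbabilityMeasure (simplexMeasure q.1) := by
  refine ⟨?_⟩
  simp only [simplexMeasure, Measure.coe_finsetSum, Finset.sum_apply, Measure.smul_apply,
    measure_univ, smul_eq_mul, mul_one]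
  rw [← ENNReal.ofReal_sum_of_nonneg fun b _ => q.2.1 b, q.2.2, ENNReal.ofReal_one]

lemma exists_simplexMeasure_eq (μ : Measure B) [IsProbabilityMeasure μ] :
    ∃ q : stdSimplex ℝ B, simplexMeasure q.1 = μ := by
  refine ⟨⟨fun b => μ.real {b}, fun _ => measureReal_nonneg, ?_⟩, ?_⟩
  · simp
  · refine Measure.ext_of_singleton fun b => ?_
    rw [simplexMeasure_singleton, ofReal_measureReal]

variable [TopologicalSpace B] [DiscreteTopology B]

lemma integral_comp_restrict_infinitePi (q : stdSimplex ℝ B) (I : Finset ℤ) (g : (I → B) → ℝ) :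
    ∫ y, g (I.restrict y) ∂(Measure.infinitePi fun _ : ℤ => simplexMeasure q.1) =
      ∑ v, (∏ j, q.1 (v j)) * g v := by
  have hg : Measurable g := measurable_of_finite g
  rw [← integral_map (φ := I.restrict) (Finset.measurable_restrict _).aemeasurable
    hg.aestronglyMeasurable, Measure.infinitePi_map_restrict, integral_fintype .of_finite]
  refine Finset.sum_congr rfl fun v _ => ?_
  rw [smul_eq_mul, Measure.real, Measure.pi_singleton, ENNReal.toReal_prod]
  congr 1
  exact Finset.prod_congr rfl fun j _ => simplexMeasure_real_singleton q (v j)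

lemma continuous_integral_infinitePi_simplexMeasure {G : (ℤ → B) → ℝ} (hG : Continuous G) :
    Continuous fun q : stdSimplex ℝ B =>
      ∫ y, G y ∂(Measure.infinitePi fun _ : ℤ => simplexMeasure q.1) := by
  classical
  rcases isEmpty_or_nonempty B with hB | ⟨⟨b₀⟩⟩
  · have : IsEmpty (stdSimplex ℝ B) := ⟨fun q => by have := q.2.2; simp at this⟩
    exact continuous_of_const fun q => isEmptyElim q
  refine continuous_of_uniform_approx_of_continuous fun u hu => ?_
  obtain ⟨ε, hε, hεu⟩ := Metric.mem_uniformity_dist.1 hu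
  obtain ⟨M, hM⟩ := exists_window hG (half_pos hε)
  set I : Finset ℤ := Finset.Icc (-M) M
  let ext (v : I → B) : ℤ → B := fun i => if h : i ∈ I then v ⟨i, h⟩ else b₀
  refine ⟨fun q => ∑ v : I → B, (∏ j, q.1 (v j)) * G (ext v), ?_, fun q => hεu ?_⟩
  · refine continuous_finsetSum _ fun v _ => (continuous_finsetProd _ fun j _ => ?_).mul
      continuous_const
    exact (continuous_apply _).comp continuous_subtype_val
  · simp only
    rw [← integral_comp_restrict_infinitePi q I fun v => G (ext v), dist_eq_norm, ← integral_sub]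
    · refine (norm_integral_le_of_norm_le_const (C := ε / 2) (ae_of_all _ fun y => ?_)).trans_lt ?_
      · refine (hM _ _ fun i hi => ?_).le
        have : i ∈ I := Finset.mem_Icc.2 (abs_le.1 hi)
        simp [ext, this]
      · simpa using half_lt_self hε
    · exact integrable_of_continuous _ hG
    · have hm : Measurable fun (y : ℤ → B) (i : I) => y i :=
        measurable_pi_lambda _ fun _ => measurable_pi_apply _
      exact Integrable.comp_measurable (g := fun v : I → B => G (ext v)) .of_finite hm

end SimplexMeasure

section BlockCode

variable {S : Type*} (n : ℕ) [NeZero n]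

/-- Concatenation of a bi-infinite sequence of blocks of length `n`. -/
def blockCode (y : ℤ → Fin n → S) : ℤ → S := fun i =>
  y (i / n) ⟨(i % n).toNat, by
    have hn : (0 : ℤ) < n := by exact_mod_cast Nat.pos_of_neZero n
    have := Int.emod_lt_of_pos i hn
    have := Int.emod_nonneg i hn.ne'
    omega⟩

lemma blockCode_apply (y : ℤ → Fin n → S) (i j : ℤ) (r : Fin n) (h : i = j * n + r) :
    blockCode n y i = y j r := by
  have hn : (0 : ℤ) < n := by exact_mod_cast Nat.pos_of_neZero n
  have hr : ((r : ℕ) : ℤ) < n := by exact_mod_cast r.2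
  have hmod : i % n = r := by
    rw [h, Int.mul_add_emod_self_right, Int.emod_eq_of_lt (by positivity) hr]
  have hdiv : i / n = j := by
    rw [h, Int.add_comm, Int.add_mul_ediv_right _ _ hn.ne',
      Int.ediv_eq_zero_of_lt (by positivity) hr, zero_add]
  unfold blockCode
  congr
  simp [hmod]

lemma exists_eq_mul_add (i : ℤ) : ∃ (j : ℤ) (r : Fin n), i = j * n + r := by
  have hn : (0 : ℤ) < n := by exact_mod_cast Nat.pos_of_neZero n
  have h1 := Int.emod_lt_of_pos i hn
  have h2 := Int.emod_nonneg i hn.ne'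
  refine ⟨i / n, ⟨(i % n).toNat, by omega⟩, ?_⟩
  have := Int.ediv_mul_add_emod i n
  simp only [Int.toNat_of_nonneg h2]
  omega

lemma blockCode_shiftMap (y : ℤ → Fin n → S) :
    blockCode n (shiftMap y) = shiftMap^[n] (blockCode n y) := by
  ext i
  obtain ⟨j, r, h⟩ := exists_eq_mul_add n i
  rw [blockCode_apply n _ i j r h, shiftMap_iterate_apply,
    blockCode_apply n y (i + n) (j + 1) r (by rw [h]; ring), shiftMap]

lemma measurable_blockCode [MeasurableSpace S] :
    Measurable (blockCode n : (ℤ → Fin n → S) → ℤ → S) :=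
  measurable_pi_lambda _ fun i => (measurable_pi_apply _).comp (measurable_pi_apply (i / n))

lemma continuous_blockCode [TopologicalSpace S] :
    Continuous (blockCode n : (ℤ → Fin n → S) → ℤ → S) :=
  continuous_pi fun i => (continuous_apply _).comp (continuous_apply (i / n))

lemma continuous_shiftMap [TopologicalSpace S] : Continuous (shiftMap : (ℤ → S) → ℤ → S) :=
  continuous_pi fun i => continuous_apply (i + 1)

end BlockCode

section BlockMeasure

variable {S : Type*} [MeasurableSpace S] (n : ℕ) [NeZero n]

lemma measurable_shiftMap_iterate_blockCode (i : ℕ) :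
    Measurable (shiftMap^[i] ∘ (blockCode n : (ℤ → Fin n → S) → ℤ → S)) :=
  (measurable_shiftMap.iterate i).comp (measurable_blockCode n)

open scoped ENNReal in
/-- The shift-invariant measure obtained by concatenating independent blocks of length `n` with
law `p` and averaging over the position of the origin in its block. -/
noncomputable def blockMeasure (p : Measure (Fin n → S)) [IsProbabilityMeasure p] :
    Measure (ℤ → S) :=
  (n : ℝ≥0∞)⁻¹ • ∑ i ∈ Finset.range n,
    (Measure.infinitePi fun _ : ℤ => p).map (shiftMap^[i] ∘ blockCode n)

variable (p : Measure (Fin n → S)) [IsProbabilityMeasure p]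

instance isProbabilityMeasure_blockMeasure : IsProbabilityMeasure (blockMeasure n p) := by
  refine ⟨?_⟩
  have (i : ℕ) : (Measure.infinitePi fun _ : ℤ => p).map (shiftMap^[i] ∘ blockCode n) univ = 1 := by
    rw [Measure.map_apply (measurable_shiftMap_iterate_blockCode n i) .univ, preimage_univ,
      measure_univ]
  simp only [blockMeasure, Measure.smul_apply, Measure.coe_finsetSum, Finset.sum_apply, this]
  simp only [Finset.sum_const, Finset.card_range, smul_eq_mul, nsmul_eq_mul, mul_one]
  exact ENNReal.inv_mul_cancel (by simpa using NeZero.ne n) (by simp)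

lemma blockMeasure_apply {s : Set (ℤ → S)} (hs : MeasurableSet s) :
    blockMeasure n p s = (n : ENNReal)⁻¹ * ∑ i ∈ Finset.range n,
      (Measure.infinitePi fun _ : ℤ => p) ((shiftMap^[i] ∘ blockCode n) ⁻¹' s) := by
  simp only [blockMeasure, Measure.smul_apply, Measure.coe_finsetSum, Finset.sum_apply, smul_eq_mul]
  congr 1
  exact Finset.sum_congr rfl fun i _ =>
    Measure.map_apply (measurable_shiftMap_iterate_blockCode n i) hs

lemma blockMeasure_real {s : Set (ℤ → S)} (hs : MeasurableSet s) :
    (blockMeasure n p).real s = ∑ i ∈ Finset.range n, (n : ℝ)⁻¹ *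
      (Measure.infinitePi fun _ : ℤ => p).real ((shiftMap^[i] ∘ blockCode n) ⁻¹' s) := by
  rw [← Finset.mul_sum, Measure.real, blockMeasure_apply n p hs, ENNReal.toReal_mul,
    ENNReal.toReal_sum fun i _ => measure_ne_top _ _]
  simp [Measure.real]

lemma measurePreserving_shiftMap_blockMeasure :
    MeasurePreserving shiftMap (blockMeasure n p) (blockMeasure n p) := by
  refine ⟨measurable_shiftMap, Measure.ext fun s hs => ?_⟩
  rw [Measure.map_apply measurable_shiftMap hs, blockMeasure_apply n p hs,
    blockMeasure_apply n p (measurable_shiftMap hs)]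
  congr 1
  set F : ℕ → ENNReal := fun i =>
    (Measure.infinitePi fun _ : ℤ => p) ((shiftMap^[i] ∘ blockCode n) ⁻¹' s) with hF
  have hstep (i : ℕ) : (shiftMap^[i] ∘ blockCode n) ⁻¹' (shiftMap ⁻¹' s) =
      (shiftMap^[i + 1] ∘ blockCode (S := S) n) ⁻¹' s := by
    rw [Function.iterate_succ']
    rfl
  have hn : F n = F 0 := by
    have : (shiftMap^[n] ∘ blockCode (S := S) n) ⁻¹' s =
        shiftMap ⁻¹' ((shiftMap^[0] ∘ blockCode n) ⁻¹' s) := by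
      ext y
      simp [blockCode_shiftMap]
    simp only [hF]
    rw [this]
    exact (measurePreserving_shiftMap_infinitePi p).measure_preimage
      (measurable_shiftMap_iterate_blockCode n 0 hs).nullMeasurableSet
  calc _ = ∑ i ∈ Finset.range n, F (i + 1) := Finset.sum_congr rfl fun i _ => by rw [hstep]
    _ = ∑ i ∈ Finset.range n, F i := by
      obtain ⟨m, rfl⟩ := Nat.exists_eq_succ_of_ne_zero (NeZero.ne n)
      rw [Finset.sum_range_succ, Finset.sum_range_succ' F, hn]

lemma ergodic_shiftMap_blockMeasure : Ergodic shiftMap (blockMeasure n p) := by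
  refine ⟨measurePreserving_shiftMap_blockMeasure n p, ⟨fun s hs hinv => ?_⟩⟩
  have hpre (i : ℕ) : (shiftMap^[i] ∘ blockCode n) ⁻¹' s = blockCode n ⁻¹' s := by
    rw [preimage_comp, Function.IsFixedPt.preimage_iterate hinv i]
  have hval : ∀ t, MeasurableSet t → shiftMap ⁻¹' t = t →
      (Measure.infinitePi fun _ : ℤ => p) (blockCode n ⁻¹' t) = 0 → blockMeasure n p t = 0 := by
    intro t ht htinv h0
    rw [blockMeasure_apply n p ht]
    refine mul_eq_zero_of_right _ (Finset.sum_eq_zero fun i _ => ?_)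
    rw [preimage_comp, Function.IsFixedPt.preimage_iterate htinv i, h0]
  have herg := (ergodic_shiftMap_infinitePi p).toPreErgodic.measure_self_or_compl_eq_zero
    (measurable_blockCode n hs) (by
      ext y
      simp only [mem_preimage, blockCode_shiftMap]
      have := Function.IsFixedPt.preimage_iterate hinv n
      exact iff_of_eq (congrArg (blockCode n y ∈ ·) this))
  rw [eventuallyConst_set']
  rcases herg with h | h
  · exact Or.inl (ae_eq_empty.2 (hval s hs hinv h))
  · exact Or.inr (ae_eq_univ.2 (hval sᶜ hs.compl (by rw [preimage_compl, hinv]) h))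

lemma integral_blockMeasure {φ : (ℤ → S) → ℝ} (hφ : Measurable φ)
    (hint : ∀ i : ℕ, Integrable (fun y => φ (shiftMap^[i] (blockCode n y)))
      (Measure.infinitePi fun _ : ℤ => p)) :
    ∫ x, φ x ∂(blockMeasure n p) = (n : ℝ)⁻¹ * ∑ i ∈ Finset.range n,
      ∫ y, φ (shiftMap^[i] (blockCode n y)) ∂(Measure.infinitePi fun _ : ℤ => p) := by
  have hm := measurable_shiftMap_iterate_blockCode (S := S) n
  rw [blockMeasure, integral_smul_measure, integral_finsetSum_measure]
  · simp only [ENNReal.toReal_inv, ENNReal.toReal_natCast, smul_eq_mul]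
    congr 1
    exact Finset.sum_congr rfl fun i _ =>
      integral_map (hm i).aemeasurable hφ.aestronglyMeasurable
  · exact fun i _ => (integrable_map_measure hφ.aestronglyMeasurable (hm i).aemeasurable).2 (hint i)

end BlockMeasure

section EntropyRate

variable {k : ℕ}

lemma measurable_window (N : ℕ) :
    Measurable fun (x : ℤ → Fin k) (p : Fin N) => x ((p : ℕ) : ℤ) :=
  measurable_pi_lambda _ fun _ => measurable_pi_apply _

lemma blockH_nonneg (μ : Measure (ℤ → Fin k)) [IsProbabilityMeasure μ] (n : ℕ) :
    0 ≤ blockH μ n := by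
  rw [blockH_eq_obsEntropy]
  exact obsEntropy_nonneg μ _

lemma blockH_zero (μ : Measure (ℤ → Fin k)) [IsProbabilityMeasure μ] : blockH μ 0 = 0 := by
  simp [blockH]

lemma blockH_add_le {μ : Measure (ℤ → Fin k)} [IsProbabilityMeasure μ]
    (hμ : MeasurePreserving shiftMap μ μ) (a b : ℕ) :
    blockH μ (a + b) ≤ blockH μ a + blockH μ b := by
  have hma := measurable_window (k := k) a
  have hmb := (measurable_window (k := k) b).comp (hμ.measurable.iterate a)
  have hb : blockH μ b = obsEntropy μ
      ((fun (x : ℤ → Fin k) (p : Fin b) => x ((p : ℕ) : ℤ)) ∘ shiftMap^[a]) := by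
    rw [← obsEntropy_map μ (hμ.measurable.iterate a) (measurable_window b), (hμ.iterate a).map_eq,
      blockH_eq_obsEntropy]
  rw [hb, blockH_eq_obsEntropy, blockH_eq_obsEntropy]
  refine le_trans (le_of_eq ?_) ((obsEntropy_comp_le μ (hma.prodMk hmb)
    fun u : (Fin a → Fin k) × (Fin b → Fin k) => Fin.append u.1 u.2).trans
      (obsEntropy_prodMk_le μ hma hmb))
  congr 1
  ext x p
  refine Fin.addCases (fun i => ?_) (fun i => ?_) p
  · simp
  · simp [shiftMap_iterate_apply, add_comm]

lemma blockH_mul_le {μ : Measure (ℤ → Fin k)} [IsProbabilityMeasure μ]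
    (hμ : MeasurePreserving shiftMap μ μ) (l n : ℕ) : blockH μ (l * n) ≤ l * blockH μ n := by
  induction l with
  | zero => simp [blockH_zero]
  | succ l ih =>
    rw [add_mul, one_mul]
    push_cast
    linarith [blockH_add_le hμ (l * n) n]

lemma bddBelow_blockH (μ : Measure (ℤ → Fin k)) [IsProbabilityMeasure μ] :
    BddBelow (range fun n : ℕ => blockH μ (n + 1) / (n + 1)) :=
  ⟨0, by
    rintro _ ⟨n, rfl⟩
    exact div_nonneg (blockH_nonneg μ _) (by positivity)⟩

lemma mEntropy_le_blockH_div (μ : Measure (ℤ → Fin k)) [IsProbabilityMeasure μ] {n : ℕ}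
    (hn : n ≠ 0) : mEntropy μ ≤ blockH μ n / n := by
  obtain ⟨m, rfl⟩ := Nat.exists_eq_succ_of_ne_zero hn
  simpa [mEntropy] using ciInf_le (bddBelow_blockH μ) m

lemma mEntropy_le_card (μ : Measure (ℤ → Fin k)) [IsProbabilityMeasure μ] : mEntropy μ ≤ k := by
  refine (mEntropy_le_blockH_div μ one_ne_zero).trans ?_
  rw [blockH_eq_obsEntropy]
  simpa using obsEntropy_le_card μ fun (x : ℤ → Fin k) (p : Fin 1) => x ((p : ℕ) : ℤ)

end EntropyRate

section BlockMeasureEntropy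

lemma obsEntropy_window_infinitePi {B : Type*} [Fintype B] [MeasurableSpace B]
    [MeasurableSingletonClass B] (p : Measure B) [IsProbabilityMeasure p] (a : ℤ) (q : ℕ) :
    obsEntropy (Measure.infinitePi fun _ : ℤ => p) (fun y (j : Fin q) => y (a + (j : ℕ))) =
      q * obsEntropy p id := by
  have hinj : Function.Injective fun j : Fin q => a + ((j : ℕ) : ℤ) := fun i j h => by
    simpa [Fin.ext_iff] using h
  have hmeas : Measurable fun (y : ℤ → B) (j : Fin q) => y (a + (j : ℕ)) :=
    measurable_pi_lambda _ fun j => measurable_pi_apply _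
  have hlaw := Measure.map_infinitePi_infinitePi_of_inj (P := fun _ : ℤ => p) hinj
  have hp : ∑ b, p.real {b} = 1 := by simp
  unfold obsEntropy
  simp only [preimage_id]
  rw [← sum_negMulLog_prod _ hp]
  refine Finset.sum_congr rfl fun v _ => ?_
  rw [← map_measureReal_apply hmeas (measurableSet_singleton v), hlaw, Measure.real,
    Measure.infinitePi_singleton_of_fintype, ENNReal.toReal_prod]
  rfl

variable {k : ℕ} (n : ℕ) [NeZero n] (p : Measure (Fin n → Fin k)) [IsProbabilityMeasure p]

lemma le_blockH_blockMeasure {q N : ℕ} (h : (q + 1) * n ≤ N) :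
    q * obsEntropy p id ≤ blockH (blockMeasure n p) N := by
  set P := Measure.infinitePi fun _ : ℤ => p
  set f := fun (x : ℤ → Fin k) (p : Fin N) => x ((p : ℕ) : ℤ)
  have hn0 : (0 : ℝ) < n := by exact_mod_cast Nat.pos_of_neZero n
  have hf : Measurable f := measurable_window N
  have hi : ∀ i ∈ Finset.range n,
      q * obsEntropy p id ≤ obsEntropy P (f ∘ shiftMap^[i] ∘ blockCode n) := by
    intro i hi
    have hin := Finset.mem_range.1 hi
    rw [← obsEntropy_window_infinitePi p 1 q]
    have hlt (j : Fin q) (r : Fin n) : (j + 1) * n + r - i < N := by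
      have : ((j : ℕ) + 2) * n ≤ (q + 1) * n := Nat.mul_le_mul_right n (by omega)
      have hr := r.2
      rw [add_mul] at this ⊢
      omega
    refine le_trans (le_of_eq ?_) (obsEntropy_comp_le P
      (hf.comp (measurable_shiftMap_iterate_blockCode n i))
      fun w (j : Fin q) (r : Fin n) => w ⟨(j + 1) * n + r - i, hlt j r⟩)
    congr 1
    ext y j r
    simp only [Function.comp_apply, f, shiftMap_iterate_apply]
    rw [blockCode_apply n y _ (1 + (j : ℕ)) r]
    have : i ≤ ((j : ℕ) + 1) * n + r := by
      rw [add_mul]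
      omega
    push_cast [this]
    ring
  rw [blockH_eq_obsEntropy]
  calc q * obsEntropy p id
      = ∑ _i ∈ Finset.range n, (n : ℝ)⁻¹ * (q * obsEntropy p id) := by
        rw [Finset.sum_const, Finset.card_range, nsmul_eq_mul]
        field_simp
    _ ≤ ∑ i ∈ Finset.range n, (n : ℝ)⁻¹ * obsEntropy P (f ∘ shiftMap^[i] ∘ blockCode n) :=
        Finset.sum_le_sum fun i h => mul_le_mul_of_nonneg_left (hi i h) (by positivity)
    _ = ∑ w, ∑ i ∈ Finset.range n, (n : ℝ)⁻¹ *
          negMulLog (P.real ((f ∘ shiftMap^[i] ∘ blockCode n) ⁻¹' {w})) := by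
        rw [Finset.sum_comm]
        simp_rw [obsEntropy, Finset.mul_sum]
    _ ≤ ∑ w, negMulLog ((blockMeasure n p).real (f ⁻¹' {w})) := by
        refine Finset.sum_le_sum fun w _ => ?_
        rw [blockMeasure_real n p (hf (measurableSet_singleton w))]
        refine concaveOn_negMulLog.le_map_sum (fun _ _ => by positivity) ?_
          fun _ _ => measureReal_nonneg
        simp [hn0.ne']

lemma blockH_blockMeasure_le (q : ℕ) :
    blockH (blockMeasure n p) (q * n) ≤ (q + 1) * obsEntropy p id + log n := by
  set P := Measure.infinitePi fun _ : ℤ => p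
  set f := fun (x : ℤ → Fin k) (p : Fin (q * n)) => x ((p : ℕ) : ℤ)
  have hn0 : (0 : ℝ) < n := by exact_mod_cast Nat.pos_of_neZero n
  have hf : Measurable f := measurable_window (q * n)
  have hi : ∀ i ∈ Finset.range n,
      obsEntropy P (f ∘ shiftMap^[i] ∘ blockCode n) ≤ (q + 1) * obsEntropy p id := by
    intro i hi
    have hin := Finset.mem_range.1 hi
    have hwin := obsEntropy_window_infinitePi p 0 (q + 1)
    push_cast at hwin
    rw [← hwin]
    have hnpos := Nat.pos_of_neZero n
    have hlt (s : Fin (q * n)) : (s + i) / n < q + 1 := by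
      rw [Nat.div_lt_iff_lt_mul hnpos, add_mul]
      omega
    refine le_trans (le_of_eq ?_) (obsEntropy_comp_le P
      (measurable_pi_lambda _ fun j => measurable_pi_apply _)
      fun (v : Fin (q + 1) → Fin n → Fin k) (s : Fin (q * n)) =>
        v ⟨(s + i) / n, hlt s⟩ ⟨(s + i) % n, Nat.mod_lt _ hnpos⟩)
    congr 1
    ext y s
    simp only [Function.comp_apply, f, shiftMap_iterate_apply]
    rw [blockCode_apply n y _ (0 + (((s + i) / n : ℕ) : ℤ)) ⟨(s + i) % n, Nat.mod_lt _ hnpos⟩]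
    rw [zero_add]
    exact_mod_cast (Nat.div_add_mod' (s + i) n).symm
  have hlog : ∑ _i ∈ Finset.range n, negMulLog (n : ℝ)⁻¹ = log n := by
    rw [Finset.sum_const, Finset.card_range, nsmul_eq_mul, negMulLog, log_inv]
    field_simp
  have hone (i : ℕ) : ∑ w, P.real ((f ∘ shiftMap^[i] ∘ blockCode n) ⁻¹' {w}) = 1 :=
    sum_measureReal_preimage_singleton_eq_one P
      (hf.comp (measurable_shiftMap_iterate_blockCode n i))
  rw [blockH_eq_obsEntropy]
  calc ∑ w, negMulLog ((blockMeasure n p).real (f ⁻¹' {w}))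
      ≤ ∑ w, ∑ i ∈ Finset.range n, negMulLog ((n : ℝ)⁻¹ *
          P.real ((f ∘ shiftMap^[i] ∘ blockCode n) ⁻¹' {w})) := by
        refine Finset.sum_le_sum fun w _ => ?_
        rw [blockMeasure_real n p (hf (measurableSet_singleton w))]
        exact negMulLog_sum_le _ _ fun i _ => mul_nonneg (by positivity) measureReal_nonneg
    _ = ∑ i ∈ Finset.range n, (negMulLog (n : ℝ)⁻¹ +
          (n : ℝ)⁻¹ * obsEntropy P (f ∘ shiftMap^[i] ∘ blockCode n)) := by
        rw [Finset.sum_comm]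
        refine Finset.sum_congr rfl fun i _ => ?_
        simp_rw [negMulLog_mul, Finset.sum_add_distrib, ← Finset.sum_mul, ← Finset.mul_sum, hone,
          one_mul]
        rfl
    _ ≤ ∑ i ∈ Finset.range n, (negMulLog (n : ℝ)⁻¹ +
          (n : ℝ)⁻¹ * ((q + 1) * obsEntropy p id)) :=
        Finset.sum_le_sum fun i h =>
          add_le_add_right (mul_le_mul_of_nonneg_left (hi i h) (by positivity)) _
    _ = (q + 1) * obsEntropy p id + log n := by
        rw [Finset.sum_add_distrib, hlog, Finset.sum_const, Finset.card_range, nsmul_eq_mul]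
        field_simp
        ring

lemma mEntropy_blockMeasure : mEntropy (blockMeasure n p) = obsEntropy p id / n := by
  have hn0 : (0 : ℝ) < n := by exact_mod_cast Nat.pos_of_neZero n
  set h := obsEntropy p id
  refine le_antisymm ?_ (le_ciInf fun m => ?_)
  · have hlim : Tendsto (fun q : ℕ => h / n + (h + log n) / n * (1 / ((q : ℝ) + 1))) atTop
        (nhds (h / n + (h + log n) / n * 0)) :=
      (tendsto_one_div_add_atTop_nhds_zero_nat.const_mul _).const_add _
    rw [mul_zero, add_zero] at hlim
    refine ge_of_tendsto' hlim fun q => ?_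
    refine (mEntropy_le_blockH_div (blockMeasure n p)
      (mul_ne_zero q.succ_ne_zero (NeZero.ne n))).trans ?_
    have := blockH_blockMeasure_le n p (q + 1)
    push_cast at this ⊢
    rw [div_le_iff₀ (by positivity)]
    refine this.trans (le_of_eq ?_)
    field_simp
    ring
  · have hlim : Tendsto (fun q : ℕ => h / n - h / (n * (m + 1)) * (1 / ((q : ℝ) + 1))) atTop
        (nhds (h / n - h / (n * (m + 1)) * 0)) :=
      (tendsto_one_div_add_atTop_nhds_zero_nat.const_mul _).const_sub _
    rw [mul_zero, sub_zero] at hlim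
    refine le_of_tendsto' hlim fun q => ?_
    have h1 := blockH_mul_le (measurePreserving_shiftMap_blockMeasure n p) ((q + 1) * n) (m + 1)
    have h2 := le_blockH_blockMeasure n p (q := (q + 1) * (m + 1) - 1)
      (N := (q + 1) * n * (m + 1)) (by
        rw [Nat.sub_add_cancel (Nat.mul_pos q.succ_pos m.succ_pos)]
        simp only [Nat.succ_eq_add_one]
        exact le_of_eq (by ring))
    have h3 := h2.trans h1
    rw [Nat.cast_sub (Nat.mul_pos q.succ_pos m.succ_pos)] at h3
    push_cast at h3
    rw [le_div_iff₀ (by positivity)]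
    have h4 : ((q : ℝ) + 1) * n * ((h / n - h / (n * (m + 1)) * (1 / ((q : ℝ) + 1))) * (m + 1)) =
        (((q : ℝ) + 1) * (m + 1) - 1) * h := by
      field_simp
    rw [← h4] at h3
    exact le_of_mul_le_mul_left h3 (by positivity)

end BlockMeasureEntropy

section Approximation

variable {k : ℕ}

lemma obsEntropy_id_map_window (μ : Measure (ℤ → Fin k)) (n : ℕ) :
    obsEntropy (μ.map fun x (r : Fin n) => x ((r : ℕ) : ℤ)) id = blockH μ n := by
  rw [blockH_eq_obsEntropy, obsEntropy_map μ (measurable_window n) measurable_id]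
  rfl

/-- The integral of `φ` against a block measure built from the `n`-block law of an invariant
measure `μ` exceeds `∫ φ dμ` by at most the contribution of the block boundaries. -/
lemma integral_blockMeasure_map_window_le {μ : Measure (ℤ → Fin k)} [IsProbabilityMeasure μ]
    (hμ : MeasurePreserving shiftMap μ μ) {φ : (ℤ → Fin k) → ℝ} (hφ : Continuous φ)
    (hpos : ∀ x, 0 ≤ φ x) {C : ℝ} (hC : ∀ x, φ x ≤ C) {ε : ℝ} {M : ℕ}
    (hM : ∀ x y : ℤ → Fin k, (∀ i : ℤ, |i| ≤ M → x i = y i) → |φ x - φ y| < ε)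
    (n : ℕ) [NeZero n] (p : Measure (Fin n → Fin k)) [IsProbabilityMeasure p]
    (hp : p = μ.map fun x (r : Fin n) => x ((r : ℕ) : ℤ)) :
    ∫ x, φ x ∂(blockMeasure n p) ≤ ∫ x, φ x ∂μ + 2 * ε + 2 * M * C / n := by
  set P := Measure.infinitePi fun _ : ℤ => p with hP
  have hn0 : (0 : ℝ) < n := by exact_mod_cast Nat.pos_of_neZero n
  obtain ⟨x₀⟩ : Nonempty (ℤ → Fin k) := nonempty_of_isProbabilityMeasure μ
  have hε : 0 < ε := (abs_nonneg _).trans_lt (hM x₀ x₀ fun _ _ => rfl)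
  have hC0 : 0 ≤ C := (hpos x₀).trans (hC x₀)
  have hcont (i : ℕ) : Continuous fun x : ℤ → Fin k => φ (shiftMap^[i] x) :=
    hφ.comp (continuous_shiftMap.iterate i)
  have hint (i : ℕ) : Integrable (fun y => φ (shiftMap^[i] (blockCode n y))) P :=
    integrable_of_continuous P ((hcont i).comp (continuous_blockCode n))
  have hintμ (i : ℕ) : Integrable (fun x => φ (shiftMap^[i] x)) μ :=
    integrable_of_continuous μ (hcont i)
  have hinv (i : ℕ) : ∫ x, φ (shiftMap^[i] x) ∂μ = ∫ x, φ x ∂μ := by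
    conv_rhs => rw [← (hμ.iterate i).map_eq]
    exact (integral_map (hμ.iterate i).measurable.aemeasurable
      hφ.measurable.aestronglyMeasurable).symm
  have hμ0 : 0 ≤ ∫ x, φ x ∂μ := integral_nonneg hpos
  let ext (w : Fin n → Fin k) : ℤ → Fin k := fun i =>
    if h : 0 ≤ i ∧ i < n then w ⟨i.toNat, by omega⟩ else x₀ i
  have hext (w : Fin n → Fin k) (r : Fin n) : ext w ((r : ℕ) : ℤ) = w r := by simp [ext]
  have hinner : ∀ i : ℕ, M ≤ i → i + M < n →
      ∫ y, φ (shiftMap^[i] (blockCode n y)) ∂P ≤ ∫ x, φ x ∂μ + 2 * ε := by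
    intro i hi1 hi2
    have hagree (x x' : ℤ → Fin k) (h : ∀ r : Fin n, x ((r : ℕ) : ℤ) = x' ((r : ℕ) : ℤ)) :
        φ (shiftMap^[i] x) ≤ φ (shiftMap^[i] x') + ε := by
      have := hM (shiftMap^[i] x) (shiftMap^[i] x') fun j hj => by
        rw [abs_le] at hj
        rw [shiftMap_iterate_apply, shiftMap_iterate_apply]
        have := h ⟨(j + i).toNat, by omega⟩
        rwa [Int.toNat_of_nonneg (by omega)] at this
      linarith [(abs_lt.1 this).2]
    have hg : Integrable (fun w => φ (shiftMap^[i] (ext w))) p := .of_finite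
    have heval := measurePreserving_eval_infinitePi (fun _ : ℤ => p) 0
    have hwin := measurable_window (k := k) n
    have hg0 : Integrable (fun y => φ (shiftMap^[i] (ext (y 0)))) P :=
      heval.integrable_comp_of_integrable hg
    have hgμ : Integrable (fun x => φ (shiftMap^[i] (ext fun r => x ((r : ℕ) : ℤ)))) μ := by
      rw [hp] at hg
      exact hg.comp_measurable hwin
    calc ∫ y, φ (shiftMap^[i] (blockCode n y)) ∂P
        ≤ ∫ y, (φ (shiftMap^[i] (ext (y 0))) + ε) ∂P := by
          refine integral_mono (hint i) (hg0.add (integrable_const ε)) fun y =>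
            hagree _ _ fun r => ?_
          rw [hext, blockCode_apply n y _ 0 r (by simp)]
      _ = ∫ w, φ (shiftMap^[i] (ext w)) ∂p + ε := by
          rw [integral_add hg0 (integrable_const ε)]
          conv_rhs => rw [← heval.map_eq]
          rw [integral_map heval.measurable.aemeasurable
            (measurable_of_finite _).aestronglyMeasurable]
          simp [hP]
      _ = ∫ x, φ (shiftMap^[i] (ext fun r => x ((r : ℕ) : ℤ))) ∂μ + ε := by
          rw [hp, integral_map hwin.aemeasurable (measurable_of_finite _).aestronglyMeasurable]
      _ ≤ ∫ x, (φ (shiftMap^[i] x) + ε) ∂μ + ε := by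
          have := integral_mono hgμ ((hintμ i).add (integrable_const ε)) fun x =>
            hagree (ext fun r => x ((r : ℕ) : ℤ)) x fun r => hext (fun r => x ((r : ℕ) : ℤ)) r
          simpa using this
      _ = ∫ x, φ x ∂μ + 2 * ε := by
          rw [integral_add (hintμ i) (integrable_const ε), hinv]
          simp
          ring
  have houter (i : ℕ) : ∫ y, φ (shiftMap^[i] (blockCode n y)) ∂P ≤ C := by
    refine (integral_mono (hint i) (integrable_const C) fun y => hC _).trans ?_
    simp
  have hterm : ∀ i ∈ Finset.range n, ∫ y, φ (shiftMap^[i] (blockCode n y)) ∂P ≤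
      (∫ x, φ x ∂μ + 2 * ε) + ((if i < M then C else 0) + if n ≤ i + M then C else 0) := by
    intro i _
    split_ifs with h1 h2 h2
    · linarith [houter i]
    · linarith [houter i]
    · linarith [houter i]
    · linarith [hinner i (by omega) (by omega)]
  have hcount1 : ∑ i ∈ Finset.range n, (if i < M then C else 0) ≤ M * C := by
    rw [← Finset.sum_filter, Finset.sum_const, nsmul_eq_mul]
    gcongr
    calc _ ≤ (Finset.range M).card := Finset.card_le_card fun i hi => by simp_all
      _ = M := Finset.card_range M
  have hcount2 : ∑ i ∈ Finset.range n, (if n ≤ i + M then C else 0) ≤ M * C := by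
    rw [← Finset.sum_filter, Finset.sum_const, nsmul_eq_mul]
    gcongr
    calc _ ≤ (Finset.Ico (n - M) n).card := Finset.card_le_card fun i hi => by
          simp only [Finset.mem_filter, Finset.mem_range, Finset.mem_Ico] at hi ⊢
          omega
      _ ≤ M := by
          rw [Nat.card_Ico]
          omega
  rw [integral_blockMeasure n p hφ.measurable hint, inv_mul_le_iff₀ hn0]
  refine (Finset.sum_le_sum hterm).trans ?_
  simp only [Finset.sum_add_distrib, Finset.sum_const, Finset.card_range, nsmul_eq_mul]
  have : (n : ℝ) * (∫ x, φ x ∂μ + 2 * ε + 2 * M * C / n) =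
      n * (∫ x, φ x ∂μ + 2 * ε) + (M * C + M * C) := by
    field_simp
    ring
  linarith

lemma continuous_obsEntropy_simplexMeasure {B : Type*} [Fintype B] [MeasurableSpace B]
    [MeasurableSingletonClass B] :
    Continuous fun q : stdSimplex ℝ B => obsEntropy (simplexMeasure q.1) id := by
  simp only [obsEntropy, preimage_id, simplexMeasure_real_singleton]
  exact continuous_finsetSum _ fun b _ => continuous_negMulLog.comp
    ((continuous_apply b).comp continuous_subtype_val)

lemma continuous_integral_blockMeasure {φ : (ℤ → Fin k) → ℝ} (hφ : Continuous φ) (n : ℕ)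
    [NeZero n] : Continuous fun q : stdSimplex ℝ (Fin n → Fin k) =>
      ∫ x, φ x ∂(blockMeasure n (simplexMeasure q.1)) := by
  have hcont (i : ℕ) : Continuous fun y : ℤ → Fin n → Fin k => φ (shiftMap^[i] (blockCode n y)) :=
    hφ.comp ((continuous_shiftMap.iterate i).comp (continuous_blockCode n))
  have heq : (fun q : stdSimplex ℝ (Fin n → Fin k) =>
      ∫ x, φ x ∂(blockMeasure n (simplexMeasure q.1))) = _ := funext fun q =>
    integral_blockMeasure n (simplexMeasure q.1) hφ.measurable fun i =>
      integrable_of_continuous _ (hcont i)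
  rw [heq]
  exact continuous_const.mul (continuous_finsetSum _ fun i _ =>
    continuous_integral_infinitePi_simplexMeasure (hcont i))

lemma obsEntropy_dirac {B : Type*} [Fintype B] [MeasurableSpace B] [MeasurableSingletonClass B]
    (b : B) : obsEntropy (Measure.dirac b) id = 0 := by
  classical
  refine Finset.sum_eq_zero fun s _ => ?_
  rw [preimage_id, Measure.real, Measure.dirac_apply' _ (measurableSet_singleton s)]
  by_cases h : b = s <;> simp [h]

lemma exists_invariant_mEntropy_pos (hk : 2 ≤ k) : ∃ μ : Measure (ℤ → Fin k),
    IsProbabilityMeasure μ ∧ MeasurePreserving shiftMap μ μ ∧ 0 < mEntropy μ := by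
  have hk1 : (1 : ℝ) < (k : ℝ) := by exact_mod_cast hk
  have : Nonempty (Fin k) := ⟨⟨0, by omega⟩⟩
  obtain ⟨q, hq⟩ : ∃ q : stdSimplex ℝ (Fin 1 → Fin k), ∀ b, q.1 b = (k : ℝ)⁻¹ :=
    ⟨⟨fun _ => (k : ℝ)⁻¹, fun _ => by positivity, by
      simp [(by positivity : (k : ℝ) ≠ 0)]⟩, fun _ => rfl⟩
  refine ⟨blockMeasure 1 (simplexMeasure q.1), inferInstance,
    measurePreserving_shiftMap_blockMeasure _ _, ?_⟩
  rw [mEntropy_blockMeasure]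
  simp only [obsEntropy, preimage_id, simplexMeasure_real_singleton]
  refine div_pos (Finset.sum_pos (fun _ _ => ?_) Finset.univ_nonempty) (by simp)
  simp only [hq, negMulLog, log_inv]
  have := log_pos hk1
  have : (0 : ℝ) < (k : ℝ)⁻¹ := by positivity
  nlinarith [mul_pos this (log_pos hk1)]

lemma exists_ergodic_mEntropy_eq {μ : Measure (ℤ → Fin k)} [IsProbabilityMeasure μ]
    (hμ : MeasurePreserving shiftMap μ μ) {φ : (ℤ → Fin k) → ℝ} (hφ : Continuous φ)
    (hpos : ∀ x, 0 < φ x) {h : ℝ} (h0 : 0 < h) (hlt : h * ∫ x, φ x ∂μ < mEntropy μ) :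
    ∃ ν : Measure (ℤ → Fin k), IsProbabilityMeasure ν ∧ Ergodic shiftMap ν ∧
      mEntropy ν = h * ∫ x, φ x ∂ν := by
  obtain ⟨C, hC⟩ : ∃ C, ∀ x, φ x ≤ C := by
    obtain ⟨C, hC⟩ := (isCompact_range hφ).bddAbove
    exact ⟨C, fun x => hC (mem_range_self x)⟩
  set δ := mEntropy μ - h * ∫ x, φ x ∂μ with hδ
  have hδ0 : 0 < δ := by linarith
  obtain ⟨M, hM⟩ := exists_window hφ (ε := δ / (4 * h)) (by positivity)
  obtain ⟨m, hm⟩ := exists_nat_gt (2 * M * C * h / (δ / 2))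
  set n := m + 1
  have hn : 2 * M * C / n * h < δ / 2 := by
    rw [div_lt_iff₀ (by positivity)] at hm
    rw [div_mul_eq_mul_div, div_lt_iff₀ (by positivity)]
    simp only [n]
    push_cast
    linarith
  have : IsProbabilityMeasure (μ.map fun x (r : Fin n) => x ((r : ℕ) : ℤ)) :=
    Measure.isProbabilityMeasure_map (measurable_window n).aemeasurable
  obtain ⟨q₁, hq₁⟩ := exists_simplexMeasure_eq (μ.map fun x (r : Fin n) => x ((r : ℕ) : ℤ))
  obtain ⟨x₀⟩ : Nonempty (ℤ → Fin k) := nonempty_of_isProbabilityMeasure μ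
  obtain ⟨q₀, hq₀⟩ := exists_simplexMeasure_eq (Measure.dirac fun r : Fin n => x₀ r)
  have : PreconnectedSpace (stdSimplex ℝ (Fin n → Fin k)) :=
    isPreconnected_iff_preconnectedSpace.1 (convex_stdSimplex ℝ _).isPreconnected
  obtain ⟨q, hq⟩ := mem_range_of_exists_le_of_exists_ge (c := 0)
    (f := fun q : stdSimplex ℝ (Fin n → Fin k) => obsEntropy (simplexMeasure q.1) id / n -
      h * ∫ x, φ x ∂(blockMeasure n (simplexMeasure q.1)))
    ((continuous_obsEntropy_simplexMeasure.div_const _).sub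
      (continuous_const.mul (continuous_integral_blockMeasure hφ n)))
    ⟨q₀, by
      have : 0 ≤ ∫ x, φ x ∂(blockMeasure n (simplexMeasure q₀.1)) :=
        integral_nonneg fun x => (hpos x).le
      have h5 : obsEntropy (simplexMeasure q₀.1) id = 0 := by rw [hq₀, obsEntropy_dirac]
      rw [h5, zero_div, zero_sub, neg_nonpos]
      positivity⟩
    ⟨q₁, by
      have h1 := integral_blockMeasure_map_window_le hμ hφ (fun x => (hpos x).le) hC hM n
        (simplexMeasure q₁.1) hq₁
      have h2 := mEntropy_le_blockH_div μ (n := n) (Nat.succ_ne_zero m)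
      rw [← obsEntropy_id_map_window, ← hq₁] at h2
      have h3 := mul_le_mul_of_nonneg_left h1 h0.le
      have h4 : h * (2 * (δ / (4 * h))) = δ / 2 := by field_simp; ring
      rw [mul_add, mul_add, h4] at h3
      linarith⟩
  refine ⟨blockMeasure n (simplexMeasure q.1), inferInstance, ergodic_shiftMap_blockMeasure _ _, ?_⟩
  rw [mEntropy_blockMeasure]
  linarith

end Approximation

/-- Let `k ≥ 2` and let `φ` be a continuous strictly positive
function on the full shift `Σ_k`. Let
`H = sup { h_μ(σ) / ∫ φ dμ : μ a shift-invariant Borel probability measure }`.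
Then `H > 0`, and for every `h ∈ (0, H)` there is an ergodic shift-invariant
Borel probability measure `μ` with `h_μ(σ) / ∫ φ dμ = h`. -/
theorem stmt5 {k : ℕ} (hk : 2 ≤ k)
    (φ : (ℤ → Fin k) → ℝ) (hφcont : Continuous φ) (hφpos : ∀ x, 0 < φ x)
    (H : ℝ)
    (hH : H = sSup {r : ℝ | ∃ μ : Measure (ℤ → Fin k),
      IsProbabilityMeasure μ ∧ MeasurePreserving shiftMap μ μ ∧
      r = mEntropy μ / ∫ x, φ x ∂μ}) :
    0 < H ∧
    ∀ h : ℝ, 0 < h → h < H →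
      ∃ μ : Measure (ℤ → Fin k), IsProbabilityMeasure μ ∧ Ergodic shiftMap μ ∧
        mEntropy μ / (∫ x, φ x ∂μ) = h := by
  have hmean (μ : Measure (ℤ → Fin k)) [IsProbabilityMeasure μ] : 0 < ∫ x, φ x ∂μ := by
    rw [integral_pos_iff_support_of_nonneg (fun x => (hφpos x).le)
      (integrable_of_continuous μ hφcont)]
    simp [Function.support_eq_univ fun x => (hφpos x).ne']
  set R : Set ℝ := {r : ℝ | ∃ μ : Measure (ℤ → Fin k),
    IsProbabilityMeasure μ ∧ MeasurePreserving shiftMap μ μ ∧ r = mEntropy μ / ∫ x, φ x ∂μ}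
  obtain ⟨μ₀, hμ₀, hinv₀, hent₀⟩ := exists_invariant_mEntropy_pos hk
  have hmem₀ : mEntropy μ₀ / ∫ x, φ x ∂μ₀ ∈ R := ⟨μ₀, hμ₀, hinv₀, rfl⟩
  have hbdd : BddAbove R := by
    obtain ⟨x₀⟩ : Nonempty (ℤ → Fin k) := nonempty_of_isProbabilityMeasure μ₀
    obtain ⟨a, -, ha⟩ := isCompact_univ.exists_isMinOn ⟨x₀, mem_univ x₀⟩ hφcont.continuousOn
    refine ⟨k / φ a, ?_⟩
    rintro _ ⟨μ, hμ, -, rfl⟩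
    refine div_le_div₀ (Nat.cast_nonneg k) (mEntropy_le_card μ) (hφpos a) ?_
    have := integral_mono (μ := μ) (integrable_const (φ a)) (integrable_of_continuous μ hφcont)
      fun x => ha (mem_univ x)
    simpa using this
  subst hH
  refine ⟨(div_pos hent₀ (hmean μ₀)).trans_le (le_csSup hbdd hmem₀), fun h h0 hlt => ?_⟩
  obtain ⟨_, ⟨μ, hμ, hinv, rfl⟩, hr⟩ := exists_lt_of_lt_csSup ⟨_, hmem₀⟩ hlt
  rw [lt_div_iff₀ (hmean μ)] at hr
  obtain ⟨ν, hν, herg, heq⟩ := exists_ergodic_mEntropy_eq hinv hφcont hφpos h0 hr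
  exact ⟨ν, hν, herg, by rw [heq, mul_div_cancel_right₀ _ (hmean ν).ne']⟩
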